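/- Let n ≥ 1, let 0 < τ₁ < τ₂, and let A : ℝ → Matrix (Fin n) (Fin n) ℝ be twice continuously differentiable on [τ₁,τ₂] with A(τ) invertible for every τ ∈ [τ₁,τ₂], and suppose A satisfies A''(τ) + (1/(2τ))·A'(τ) = M(τ)·A(τ) on [τ₁,τ₂], where M : ℝ → Matrix (Fin n) (Fin n) ℝ is continuous with M(τ) symmetric for every τ, and suppose B(τ₁) := A'(τ₁)·A(τ₁)⁻¹ is symmetric. Define α(τ) := -(1/2)·log(det(A(τ)ᵀ·A(τ))). Then for every τ ∈ [τ₁,τ₂]: d/dτ(τ^(3/2) · α'(τ)) ≥ -τ^(3/2)·trace(M(τ)) - (n/4)·τ^(-1/2). -/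

import Mathlib

open Matrix Set

section MatrixCalculus

variable {n : Type*} [Fintype n]

theorem hasDerivWithinAt_matrix_trace {A : ℝ → Matrix n n ℝ} {A' : Matrix n n ℝ} {s : Set ℝ}
    {x : ℝ} (hA : ∀ i j, HasDerivWithinAt (fun t => A t i j) (A' i j) s x) :
    HasDerivWithinAt (fun t => (A t).trace) A'.trace s x :=
  HasDerivWithinAt.fun_sum fun i _ => hA i i

theorem hasDerivWithinAt_matrix_mul {A B : ℝ → Matrix n n ℝ} {A' B' : Matrix n n ℝ} {s : Set ℝ}
    {x : ℝ} (hA : ∀ i j, HasDerivWithinAt (fun t => A t i j) (A' i j) s x)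
    (hB : ∀ i j, HasDerivWithinAt (fun t => B t i j) (B' i j) s x) (i j : n) :
    HasDerivWithinAt (fun t => (A t * B t) i j) ((A' * B x + A x * B') i j) s x := by
  simp only [mul_apply, Matrix.add_apply, ← Finset.sum_add_distrib]
  exact HasDerivWithinAt.fun_sum fun k _ => (hA i k).fun_mul (hB k j)

variable [DecidableEq n]

/-- Jacobi's formula for the derivative of a determinant. -/
theorem hasDerivWithinAt_matrix_det {A : ℝ → Matrix n n ℝ} {A' : Matrix n n ℝ} {s : Set ℝ} {x : ℝ}
    (hA : ∀ i j, HasDerivWithinAt (fun t => A t i j) (A' i j) s x) :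
    HasDerivWithinAt (fun t => (A t).det) ((A x).adjugate * A').trace s x := by
  let D : ContinuousMultilinearMap ℝ (fun _ : n => n → ℝ) ℝ :=
    { toMultilinearMap := (detRowAlternating : (n → ℝ) [⋀^n]→ₗ[ℝ] ℝ).toMultilinearMap
      cont := Continuous.matrix_det (A := fun M : n → n → ℝ => Matrix.of M) continuous_id }
  have hrows : HasDerivWithinAt (fun t i => A t i) (fun i => A' i) s x :=
    hasDerivWithinAt_pi.2 fun i => hasDerivWithinAt_pi.2 fun j => hA i j
  have h := (D.hasFDerivAt (x := fun i => A x i)).comp_hasDerivWithinAt x hrows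
  have hval : D.linearDeriv (fun i => A x i) (fun i => A' i)
      = ((A x).adjugate * A').trace := by
    rw [ContinuousMultilinearMap.linearDeriv_apply, trace_mul_comm, trace]
    refine Finset.sum_congr rfl fun i _ => ?_
    change ((A x).updateRow i (A' i)).det = _
    rw [← cramer_transpose_apply, cramer_eq_adjugate_mulVec, ← adjugate_transpose,
      mulVec_transpose, diag_apply, mul_apply]
    rfl
  rw [← hval]
  exact h

open scoped Matrix.Norms.Operator in
theorem hasDerivWithinAt_matrix_inv {A : ℝ → Matrix n n ℝ} {A' : Matrix n n ℝ} {s : Set ℝ} {x : ℝ}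
    (hA : ∀ i j, HasDerivWithinAt (fun t => A t i j) (A' i j) s x) (hx : IsUnit (A x)) (i j : n) :
    HasDerivWithinAt (fun t => (A t)⁻¹ i j) ((-((A x)⁻¹ * A' * (A x)⁻¹)) i j) s x := by
  have hmat : HasDerivWithinAt A A' s x :=
    hasDerivWithinAt_pi.2 fun i => hasDerivWithinAt_pi.2 fun j => hA i j
  obtain ⟨u, hu⟩ := hx
  have hinv : HasFDerivAt Ring.inverse
      (-ContinuousLinearMap.mulLeftRight ℝ (Matrix n n ℝ) ↑u⁻¹ ↑u⁻¹) (A x) :=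
    hu ▸ hasFDerivAt_ringInverse u
  have h := hinv.comp_hasDerivWithinAt x hmat
  have hij := hasDerivWithinAt_pi.1 (hasDerivWithinAt_pi.1 h i) j
  have hval : -((A x)⁻¹ * A' * (A x)⁻¹)
      = (-ContinuousLinearMap.mulLeftRight ℝ (Matrix n n ℝ) ↑u⁻¹ ↑u⁻¹) A' := by
    rw [← hu, ← coe_units_inv]
    rfl
  rw [hval]
  simp only [nonsing_inv_eq_ringInverse]
  exact hij

/-- The derivative of `log det (Aᵀ A)` is twice the trace of the logarithmic derivative of `A`. -/
theorem hasDerivWithinAt_log_det_transpose_mul_self {A : ℝ → Matrix n n ℝ} {A' : Matrix n n ℝ}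
    {s : Set ℝ} {x : ℝ} (hA : ∀ i j, HasDerivWithinAt (fun t => A t i j) (A' i j) s x)
    (hx : IsUnit (A x)) :
    HasDerivWithinAt (fun t => Real.log ((A t)ᵀ * A t).det) (2 * (A' * (A x)⁻¹).trace) s x := by
  have hdet : (A x).det ≠ 0 := ((isUnit_iff_isUnit_det _).1 hx).ne_zero
  have h := ((hasDerivWithinAt_matrix_det hA).log hdet).const_mul 2
  have hfun : (fun t => Real.log ((A t)ᵀ * A t).det) = fun t => 2 * Real.log (A t).det := by
    ext t
    rw [det_mul, det_transpose, ← sq, Real.log_pow]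
    norm_num
  rw [hfun, trace_mul_comm, inv_def, Ring.inverse_eq_inv', smul_mul, trace_smul, smul_eq_mul,
    inv_mul_eq_div]
  exact h

/-- The trace of the square of a symmetric matrix is bounded below by its linearization at a
scalar matrix. -/
theorem trace_mul_self_ge_of_isSymm {B : Matrix n n ℝ} (hB : B.IsSymm) (c : ℝ) :
    2 * c * B.trace - Fintype.card n * c ^ 2 ≤ (B * B).trace := by
  have hC : (B - c • (1 : Matrix n n ℝ))ᵀ = B - c • (1 : Matrix n n ℝ) := by
    simp [hB.eq]
  have h : 0 ≤ ((B - c • (1 : Matrix n n ℝ))ᵀ * (B - c • (1 : Matrix n n ℝ))).trace := by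
    simp only [trace, diag_apply, mul_apply, transpose_apply]
    exact Finset.sum_nonneg fun i _ => Finset.sum_nonneg fun j _ => mul_self_nonneg _
  rw [hC] at h
  simp only [sub_mul, mul_sub, smul_mul, Matrix.mul_smul, Matrix.one_mul, Matrix.mul_one, trace_sub, trace_smul,
    trace_one, smul_eq_mul] at h
  linarith

/-- Along `A'' + (1 / (2 τ)) A' = M A` with `M` symmetric, symmetry of `A' A⁻¹` propagates from the
initial time. -/
theorem isSymm_mul_inv_of_matrix_ode {a b : ℝ} (ha : 0 < a) {A A' A'' M : ℝ → Matrix n n ℝ}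
    (hA' : ∀ t ∈ Icc a b, ∀ i j, HasDerivWithinAt (fun t => A t i j) (A' t i j) (Icc a b) t)
    (hA'' : ∀ t ∈ Icc a b, ∀ i j, HasDerivWithinAt (fun t => A' t i j) (A'' t i j) (Icc a b) t)
    (hinv : ∀ t ∈ Icc a b, IsUnit (A t)) (hM : ∀ t ∈ Icc a b, (M t).IsSymm)
    (hODE : ∀ t ∈ Icc a b, A'' t + (1 / (2 * t)) • A' t = M t * A t)
    (h₀ : (A' a * (A a)⁻¹).IsSymm) {t : ℝ} (ht : t ∈ Icc a b) : (A' t * (A t)⁻¹).IsSymm := by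
  set W : ℝ → Matrix n n ℝ := fun t => (A t)ᵀ * A' t - (A' t)ᵀ * A t with hWdef
  have hsymm_iff : ∀ t ∈ Icc a b, (A' t * (A t)⁻¹).IsSymm ↔ W t = 0 := by
    intro t ht
    have hdet := (isUnit_iff_isUnit_det _).1 (hinv t ht)
    have hdetT : IsUnit (A t)ᵀ.det := by rwa [det_transpose]
    have hleft : (A t)ᵀ * (A' t * (A t)⁻¹) * A t = (A t)ᵀ * A' t := by
      rw [Matrix.mul_assoc, Matrix.mul_assoc, nonsing_inv_mul _ hdet, Matrix.mul_one]
    have hright : (A t)ᵀ * (A' t * (A t)⁻¹)ᵀ * A t = (A' t)ᵀ * A t := by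
      rw [transpose_mul, transpose_nonsing_inv, mul_nonsing_inv_cancel_left _ _ hdetT]
    rw [hWdef]
    simp only
    rw [sub_eq_zero, ← hleft, ← hright]
    refine ⟨fun h => by rw [h.eq], fun h => ?_⟩
    have hcancel := (hinv t ht).mul_right_cancel h
    exact (((isUnit_iff_isUnit_det _).2 hdetT).mul_left_cancel hcancel).symm
  have hWderiv : ∀ t ∈ Icc a b, ∀ i j,
      HasDerivWithinAt (fun t => W t i j) ((-(1 / (2 * t)) • W t) i j) (Icc a b) t := by
    intro t ht i j
    have h₁ := hasDerivWithinAt_matrix_mul (A := fun t => (A t)ᵀ) (A' := (A' t)ᵀ)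
      (fun i j => hA' t ht j i) (hA'' t ht) i j
    have h₂ := hasDerivWithinAt_matrix_mul (A := fun t => (A' t)ᵀ) (A' := (A'' t)ᵀ)
      (fun i j => hA'' t ht j i) (hA' t ht) i j
    have hA''eq : A'' t = M t * A t - (1 / (2 * t)) • A' t := eq_sub_of_add_eq (hODE t ht)
    have hval : (-(1 / (2 * t)) • W t)
        = ((A' t)ᵀ * A' t + (A t)ᵀ * A'' t) - ((A'' t)ᵀ * A t + (A' t)ᵀ * A' t) := by
      rw [hA''eq]
      simp only [hWdef, transpose_sub, transpose_mul, transpose_smul, (hM t ht).eq, mul_sub,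
        sub_mul, smul_mul, Matrix.mul_smul, Matrix.mul_assoc, smul_sub, neg_smul]
      abel
    rw [hval]
    exact h₁.sub h₂
  have hWzero : W t = 0 := by
    ext i j
    have hconst : ∀ x ∈ Icc a b, √x * W x i j = √a * W a i j := by
      have hderiv : ∀ x ∈ Icc a b,
          HasDerivWithinAt (fun x => √x * W x i j) 0 (Icc a b) x := by
        intro x hx
        have hxpos : 0 < x := ha.trans_le hx.1
        refine ((Real.hasDerivAt_sqrt hxpos.ne').hasDerivWithinAt.mul
          (hWderiv x hx i j)).congr_deriv ?_
        have hs : √x ≠ 0 := (Real.sqrt_pos.2 hxpos).ne'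
        have hsq : √x ^ 2 = x := Real.sq_sqrt hxpos.le
        simp only [Matrix.smul_apply, smul_eq_mul]
        field_simp
        rw [hsq]
        ring
      refine constant_of_has_deriv_right_zero (fun x hx => (hderiv x hx).continuousWithinAt)
        fun x hx => ?_
      exact (hderiv x (Ico_subset_Icc_self hx)).mono_of_mem_nhdsWithin
        (Icc_mem_nhdsGE_of_mem hx)
    have hWa : W a = 0 := (hsymm_iff a ⟨le_rfl, ht.1.trans ht.2⟩).1 h₀
    have h := hconst t ht
    rw [hWa, Matrix.zero_apply, mul_zero] at h
    exact (mul_eq_zero.1 h).resolve_left (Real.sqrt_pos.2 (ha.trans_le ht.1)).ne'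
  exact (hsymm_iff t ht).2 hWzero

end MatrixCalculus

theorem matrix_ode_second_differential_inequality
    (n : ℕ) (hn : 1 ≤ n) (τ₁ τ₂ : ℝ) (hτ₁ : 0 < τ₁) (hτ₁₂ : τ₁ < τ₂)
    (A A' A'' M : ℝ → Matrix (Fin n) (Fin n) ℝ)
    -- A is twice continuously differentiable on [τ₁,τ₂], with entrywise
    -- first derivative A' and second derivative A''
    (hA' : ∀ τ ∈ Icc τ₁ τ₂, ∀ i j,
      HasDerivWithinAt (fun t => A t i j) (A' τ i j) (Icc τ₁ τ₂) τ)
    (hA'' : ∀ τ ∈ Icc τ₁ τ₂, ∀ i j,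
      HasDerivWithinAt (fun t => A' t i j) (A'' τ i j) (Icc τ₁ τ₂) τ)
    (hA''cont : ∀ i j, ContinuousOn (fun t => A'' t i j) (Icc τ₁ τ₂))
    -- A(τ) is invertible on [τ₁,τ₂]
    (hinv : ∀ τ ∈ Icc τ₁ τ₂, IsUnit (A τ))
    -- M is continuous, and M(τ) is symmetric for every τ
    (hM : ∀ i j, ContinuousOn (fun t => M t i j) (Icc τ₁ τ₂))
    (hMsymm : ∀ τ ∈ Icc τ₁ τ₂, (M τ)ᵀ = M τ)
    -- the second-order linear ODE  A'' + (1/(2τ))·A' = M·A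
    (hODE : ∀ τ ∈ Icc τ₁ τ₂, A'' τ + (1 / (2 * τ)) • A' τ = M τ * A τ)
    -- B(τ₁) := A'(τ₁)·A(τ₁)⁻¹ is symmetric
    (hB₁symm : (A' τ₁ * (A τ₁)⁻¹)ᵀ = A' τ₁ * (A τ₁)⁻¹)
    -- α(τ) := -(1/2)·log det(Aᵀ A)
    (α : ℝ → ℝ) (hα : ∀ τ, α τ = -(1 / 2) * Real.log ((A τ)ᵀ * A τ).det) :
    ∀ τ ∈ Icc τ₁ τ₂,
      derivWithin (fun t => t ^ ((3 : ℝ) / 2) * derivWithin α (Icc τ₁ τ₂) t) (Icc τ₁ τ₂) τ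
        ≥ -(τ ^ ((3 : ℝ) / 2)) * (M τ).trace - (n / 4) * τ ^ (-(1 : ℝ) / 2) := by
  intro τ hτ
  have hpos : 0 < τ := hτ₁.trans_le hτ.1
  set B : ℝ → Matrix (Fin n) (Fin n) ℝ := fun t => A' t * (A t)⁻¹ with hB
  have hBsymm : (B τ).IsSymm :=
    isSymm_mul_inv_of_matrix_ode hτ₁ hA' hA'' hinv hMsymm hODE hB₁symm hτ
  have hαderiv : ∀ t ∈ Icc τ₁ τ₂, derivWithin α (Icc τ₁ τ₂) t = -(B t).trace := by
    intro t ht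
    have h := (hasDerivWithinAt_log_det_transpose_mul_self (hA' t ht) (hinv t ht)).const_mul
      (-(1 / 2))
    rw [funext hα, h.derivWithin (uniqueDiffOn_Icc hτ₁₂ t ht)]
    ring
  have hBderiv := hasDerivWithinAt_matrix_trace
    (hasDerivWithinAt_matrix_mul (hA'' τ hτ) (hasDerivWithinAt_matrix_inv (hA' τ hτ) (hinv τ hτ)))
  have hA''eq : A'' τ = M τ * A τ - (1 / (2 * τ)) • A' τ := eq_sub_of_add_eq (hODE τ hτ)
  have hRiccati : A'' τ * (A τ)⁻¹ + A' τ * -((A τ)⁻¹ * A' τ * (A τ)⁻¹)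
      = M τ - (1 / (2 * τ)) • B τ - B τ * B τ := by
    rw [hA''eq, sub_mul, smul_mul,
      mul_nonsing_inv_cancel_right _ _ ((isUnit_iff_isUnit_det _).1 (hinv τ hτ))]
    simp only [hB, mul_neg, Matrix.mul_assoc, sub_eq_add_neg]
  rw [hRiccati] at hBderiv
  have hpow : HasDerivAt (fun t : ℝ => t ^ ((3 : ℝ) / 2)) (3 / 2 * τ ^ ((3 : ℝ) / 2 - 1)) τ :=
    Real.hasDerivAt_rpow_const (Or.inl hpos.ne')
  rw [derivWithin_congr (fun t ht => by rw [hαderiv t ht]) (by rw [hαderiv τ hτ]),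
    (hpow.hasDerivWithinAt.fun_mul hBderiv.fun_neg).derivWithin (uniqueDiffOn_Icc hτ₁₂ τ hτ)]
  have htrace := trace_mul_self_ge_of_isSymm hBsymm (1 / (2 * τ))
  have hpow₁ : τ ^ ((3 : ℝ) / 2 - 1) = τ ^ (-(1 : ℝ) / 2) * τ := by
    rw [← Real.rpow_add_one hpos.ne']
    norm_num
  have hpow₂ : τ ^ ((3 : ℝ) / 2) = τ ^ (-(1 : ℝ) / 2) * τ ^ 2 := by
    rw [← Real.rpow_natCast τ 2, ← Real.rpow_add hpos]
    norm_num
  rw [hpow₁, hpow₂]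
  simp only [trace_sub, trace_smul, smul_eq_mul, Fintype.card_fin] at htrace ⊢
  have hscaled := mul_le_mul_of_nonneg_left htrace
    (mul_nonneg (Real.rpow_nonneg hpos.le (-(1 : ℝ) / 2)) (sq_nonneg τ))
  have hlhs : τ ^ (-(1 : ℝ) / 2) * τ ^ 2 * (2 * (1 / (2 * τ)) * (B τ).trace - n * (1 / (2 * τ)) ^ 2)
      = τ ^ (-(1 : ℝ) / 2) * τ * (B τ).trace - n / 4 * τ ^ (-(1 : ℝ) / 2) := by
    field_simp
    ring
  have hcross : τ ^ (-(1 : ℝ) / 2) * τ ^ 2 * (1 / (2 * τ) * (B τ).trace)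
      = τ ^ (-(1 : ℝ) / 2) * τ * (B τ).trace / 2 := by
    field_simp
  rw [hlhs] at hscaled
  linarith
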